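/- Two 3×3 boards with nine distinct letters have the same set of words if and only if they are a rotation or reflection of each other. Precisely: for bijections B, B' : Fin 3 × Fin 3 → Fin 9, the set of all words of B (of every length ≥ 2) equals the set of all words of B' if and only if B' = B ∘ σ for some σ in the symmetry group of the square acting on Fin 3 × Fin 3. -/

import Mathlib

/-- King-move adjacency on the cells of a 3×3 grid: two cells are adjacent if they are
distinct and their coordinates differ by at most 1 in each component. -/
def cellAdj (a b : Fin 3 × Fin 3) : Prop :=
  a ≠ b ∧ |(a.1.val : ℤ) - (b.1.val : ℤ)| ≤ 1 ∧ |(a.2.val : ℤ) - (b.2.val : ℤ)| ≤ 1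

/-- `w` is a word of the board `B`: a list of letters of length at least 2 of the form
`B c₁, …, B c_k` where the cells `c₁, …, c_k` are pairwise distinct and consecutive
cells are adjacent.  (For a bijective board this says exactly that `w` is a list of
pairwise distinct letters whose consecutive letters occupy adjacent cells.) -/
def IsWordOf {A : Type*} (B : Fin 3 × Fin 3 → A) (w : List A) : Prop :=
  2 ≤ w.length ∧
    ∃ cs : List (Fin 3 × Fin 3), cs.map B = w ∧ cs.Nodup ∧ cs.Chain' cellAdj

/-- The set `W(B)` of all words of the board `B`. -/
def Words {A : Type*} (B : Fin 3 × Fin 3 → A) : Set (List A) :=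
  {w | IsWordOf B w}

/-- The set `W_k(B)` of all `k`-letter words of the board `B`. -/
def WordsOfLen {A : Type*} (B : Fin 3 × Fin 3 → A) (k : ℕ) : Set (List A) :=
  {w | w.length = k ∧ IsWordOf B w}

/-- Rotation of the 3×3 grid by 90 degrees. -/
def rotCell (c : Fin 3 × Fin 3) : Fin 3 × Fin 3 := (c.2, 2 - c.1)

/-- Reflection of the 3×3 grid along the main diagonal. -/
def reflCell (c : Fin 3 × Fin 3) : Fin 3 × Fin 3 := (c.2, c.1)

/-- The symmetry group of the square acting on the 3×3 grid: the eight
rotations and reflections. -/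
def squareSymm : Set ((Fin 3 × Fin 3) → (Fin 3 × Fin 3)) :=
  {id, rotCell, rotCell ∘ rotCell, rotCell ∘ rotCell ∘ rotCell,
   reflCell, reflCell ∘ rotCell, reflCell ∘ rotCell ∘ rotCell,
   reflCell ∘ rotCell ∘ rotCell ∘ rotCell}

/-- Two boards are equivalent if one is obtained from the other by a symmetry
of the square. -/
def BoardEquiv {A : Type*} (B B' : Fin 3 × Fin 3 → A) : Prop :=
  ∃ σ ∈ squareSymm, B' = B ∘ σ

theorem cellAdj_iff_nat_le (a b : Fin 3 × Fin 3) :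
    cellAdj a b ↔ a ≠ b ∧ (a.1.val ≤ b.1.val + 1 ∧ b.1.val ≤ a.1.val + 1) ∧
      (a.2.val ≤ b.2.val + 1 ∧ b.2.val ≤ a.2.val + 1) := by
  rw [cellAdj, abs_le, abs_le]
  refine and_congr_right' (and_congr ?_ ?_) <;> omega

instance : DecidableRel cellAdj := fun a b =>
  decidable_of_iff' _ (cellAdj_iff_nat_le a b)

/-- The number of cells adjacent to `c`. -/
def cellDegree (c : Fin 3 × Fin 3) : ℕ :=
  (Finset.univ.filter (cellAdj c)).card

/-- An enumeration of the elements of `squareSymm`. -/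
def squareSymmEnum : Fin 8 → (Fin 3 × Fin 3) → (Fin 3 × Fin 3) :=
  ![id, rotCell, rotCell ∘ rotCell, rotCell ∘ rotCell ∘ rotCell,
   reflCell, reflCell ∘ rotCell, reflCell ∘ rotCell ∘ rotCell,
   reflCell ∘ rotCell ∘ rotCell ∘ rotCell]

theorem mem_squareSymm_iff (σ : (Fin 3 × Fin 3) → (Fin 3 × Fin 3)) :
    σ ∈ squareSymm ↔ ∃ i, squareSymmEnum i = σ := by
  simp [squareSymm, squareSymmEnum, Fin.exists_fin_succ, eq_comm]

theorem injective_of_mem_squareSymm {σ : (Fin 3 × Fin 3) → (Fin 3 × Fin 3)}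
    (hσ : σ ∈ squareSymm) : Function.Injective σ := by
  have key : ∀ i a b, squareSymmEnum i a = squareSymmEnum i b → a = b := by decide +kernel
  obtain ⟨i, rfl⟩ := (mem_squareSymm_iff σ).1 hσ
  exact key i

theorem cellAdj_apply_iff_of_mem_squareSymm {σ : (Fin 3 × Fin 3) → (Fin 3 × Fin 3)}
    (hσ : σ ∈ squareSymm) (a b : Fin 3 × Fin 3) :
    cellAdj (σ a) (σ b) ↔ cellAdj a b := by
  have key : ∀ i a b, cellAdj (squareSymmEnum i a) (squareSymmEnum i b) ↔ cellAdj a b := by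
    decide +kernel
  obtain ⟨i, rfl⟩ := (mem_squareSymm_iff σ).1 hσ
  exact key i a b

/-- A corner cell and its two neighbouring edge cells determine a symmetry of the square. -/
theorem exists_squareSymmEnum_apply_eq :
    ∀ p q r, cellDegree p = cellDegree (0, 0) → cellDegree q = cellDegree (0, 1) →
      cellDegree r = cellDegree (1, 0) → cellAdj p q → cellAdj p r → q ≠ r →
      ∃ i, squareSymmEnum i (0, 0) = p ∧ squareSymmEnum i (0, 1) = q ∧ squareSymmEnum i (1, 0) = r := by
  decide +kernel

/-- A cell is determined by its degree and its adjacency to a corner cell and the two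
edge cells next to that corner. -/
theorem eq_squareSymmEnum_apply :
    ∀ i c d, cellDegree d = cellDegree c →
      (cellAdj (squareSymmEnum i (0, 0)) d ↔ cellAdj (0, 0) c) →
      (cellAdj (squareSymmEnum i (0, 1)) d ↔ cellAdj (0, 1) c) →
      (cellAdj (squareSymmEnum i (1, 0)) d ↔ cellAdj (1, 0) c) → d = squareSymmEnum i c := by
  decide +kernel

theorem cellDegree_apply (e : Fin 3 × Fin 3 ≃ Fin 3 × Fin 3)
    (he : ∀ a b, cellAdj (e a) (e b) ↔ cellAdj a b) (c : Fin 3 × Fin 3) :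
    cellDegree (e c) = cellDegree c := by
  refine (Finset.card_equiv e fun a => ?_).symm
  simp [he]

/-- Every automorphism of the king's graph on the 3×3 grid is a symmetry of the square. -/
theorem mem_squareSymm_of_cellAdj_iff (e : Fin 3 × Fin 3 ≃ Fin 3 × Fin 3)
    (he : ∀ a b, cellAdj (e a) (e b) ↔ cellAdj a b) : ⇑e ∈ squareSymm := by
  obtain ⟨i, hp, hq, hr⟩ := exists_squareSymmEnum_apply_eq (e (0, 0)) (e (0, 1)) (e (1, 0))
    (cellDegree_apply e he _) (cellDegree_apply e he _) (cellDegree_apply e he _)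
    ((he _ _).2 (by decide +kernel)) ((he _ _).2 (by decide +kernel))
    (e.injective.ne (by decide))
  refine (mem_squareSymm_iff e).2 ⟨i, funext fun c => ?_⟩
  exact (eq_squareSymmEnum_apply i c (e c) (cellDegree_apply e he c)
    (hp ▸ he _ _) (hq ▸ he _ _) (hr ▸ he _ _)).symm

theorem words_comp_subset {A : Type*} (B : Fin 3 × Fin 3 → A)
    {σ : (Fin 3 × Fin 3) → (Fin 3 × Fin 3)} (hσ : Function.Injective σ)
    (h : ∀ a b, cellAdj a b → cellAdj (σ a) (σ b)) : Words (B ∘ σ) ⊆ Words B := by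
  rintro w ⟨hw, cs, rfl, hcs, hchain⟩
  exact ⟨hw, cs.map σ, by simp, hcs.map hσ, List.isChain_map_of_isChain σ h hchain⟩

theorem words_comp_equiv {A : Type*} (B : Fin 3 × Fin 3 → A) (e : Fin 3 × Fin 3 ≃ Fin 3 × Fin 3)
    (he : ∀ a b, cellAdj (e a) (e b) ↔ cellAdj a b) : Words (B ∘ e) = Words B := by
  refine (words_comp_subset B e.injective fun a b => (he a b).2).antisymm ?_
  have h := words_comp_subset (B ∘ e) e.symm.injective fun a b hab =>
    (he _ _).1 (by simpa using hab)
  simpa [Function.comp_assoc] using h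

theorem pair_mem_words_iff {A : Type*} {B : Fin 3 × Fin 3 → A} (hB : Function.Injective B)
    (a b : Fin 3 × Fin 3) : [B a, B b] ∈ Words B ↔ cellAdj a b := by
  constructor
  · rintro ⟨-, cs, hcs, -, hchain⟩
    obtain rfl : cs = [a, b] := hB.list_map (by simpa using hcs)
    exact List.isChain_pair.1 hchain
  · intro h
    exact ⟨le_rfl, [a, b], rfl, by simpa using h.1, List.isChain_pair.2 h⟩

/-- Two 3×3 boards with nine distinct letters have the same set of words if and only
if they are a rotation or reflection of each other. -/
theorem same_words_iff_symm (B B' : Fin 3 × Fin 3 → Fin 9)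
    (hB : Function.Bijective B) (hB' : Function.Bijective B') :
    Words B = Words B' ↔ BoardEquiv B B' := by
  constructor
  · intro hW
    set e : Fin 3 × Fin 3 ≃ Fin 3 × Fin 3 :=
      (Equiv.ofBijective B' hB').trans (Equiv.ofBijective B hB).symm
    have hBe : ∀ c, B (e c) = B' c := fun c => (Equiv.ofBijective B hB).apply_symm_apply (B' c)
    refine ⟨e, mem_squareSymm_of_cellAdj_iff e fun a b => ?_, funext fun c => (hBe c).symm⟩
    rw [← pair_mem_words_iff hB.injective, hBe, hBe, hW, pair_mem_words_iff hB'.injective]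
  · rintro ⟨σ, hσ, rfl⟩
    exact (words_comp_equiv B
      (Equiv.ofBijective σ (Finite.injective_iff_bijective.1 (injective_of_mem_squareSymm hσ)))
      (cellAdj_apply_iff_of_mem_squareSymm hσ)).symm
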